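/- arXiv:2201.08915 — 2 statements merged into one kernel-verified Lean document; each statement's English description precedes it below -/
import Mathlib

section
/- In any alternative ring, [(a,x,y)^2, a] = 0, where (x,y,z) = (xy)z - x(yz) is the associator and [a,b] = ab - ba. -/
variable {A : Type*} [NonUnitalNonAssocRing A]

/-- Commutator `[x,y] = xy - yx`. -/
def altComm (x y : A) : A := x * y - y * x

/-- Associator `(x,y,z) = (xy)z - x(yz)`. -/
def altAssoc (x y z : A) : A := (x * y) * z - x * (y * z)

/-- Jordan product `x ∘ y = xy + yx`. -/
def altSop (x y : A) : A := x * y + y * x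

/-- Jacobian `J(a,b,c) = [[a,b],c] + [[b,c],a] + [[c,a],b]`. -/
def altJac (x y z : A) : A := altComm (altComm x y) z + altComm (altComm y z) x + altComm (altComm z x) y

/-- `D(a,b,c) = (a∘b)∘c - (a∘c)∘b`. -/
def altDop (x y z : A) : A := altSop (altSop x y) z - altSop (altSop x z) y

theorem aux_sk12 (hl : ∀ x y : A, altAssoc x x y = 0) (x y z : A) :
    altAssoc x y z = - altAssoc y x z := by
  have h := hl (x + y) z
  have h1 := hl x z
  have h2 := hl y z
  have : altAssoc x y z + altAssoc y x z
      = altAssoc (x + y) (x + y) z - altAssoc x x z - altAssoc y y z := by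
    simp only [altAssoc, mul_add, add_mul]; abel
  rw [h, h1, h2] at this
  exact eq_neg_of_add_eq_zero_left (by simpa using this)

theorem aux_sk23 (hr : ∀ x y : A, altAssoc y x x = 0) (x y z : A) :
    altAssoc x y z = - altAssoc x z y := by
  have h := hr (y + z) x
  have h1 := hr y x
  have h2 := hr z x
  have : altAssoc x y z + altAssoc x z y
      = altAssoc x (y + z) (y + z) - altAssoc x y y - altAssoc x z z := by
    simp only [altAssoc, mul_add, add_mul]; abel
  rw [h, h1, h2] at this
  exact eq_neg_of_add_eq_zero_left (by simpa using this)

theorem aux_teich (w x y z : A) :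
    altAssoc (w * x) y z - altAssoc w (x * y) z + altAssoc w x (y * z)
      = w * altAssoc x y z + altAssoc w x y * z := by
  simp only [altAssoc, mul_sub, sub_mul]; abel

/-- `(s, ws, z) = s (s,w,z)`. -/
theorem aux_A2 (hl : ∀ x y : A, altAssoc x x y = 0) (hr : ∀ x y : A, altAssoc y x x = 0)
    (s w z : A) : altAssoc s (w * s) z = s * altAssoc s w z := by
  have e1 := aux_teich s s z w
  have e2 := aux_teich w s s z
  rw [hl s (z * w), hl s z, zero_mul, add_zero, add_zero] at e1
  rw [hl s z, hr s w, mul_zero, zero_mul, add_zero] at e2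
  rw [aux_sk12 hl (w * s) s z, aux_sk12 hl w (s * s) z, aux_sk23 hr (s * s) w z,
    aux_sk12 hl w s (s * z), aux_sk23 hr s w (s * z)] at e2
  rw [aux_sk23 hr s w z, mul_neg, ← e1]
  rw [← sub_eq_zero]
  rw [← neg_eq_zero, ← e2]
  abel

/-- `(s, sw, z) = (s,w,z) s`. -/
theorem aux_A1 (hl : ∀ x y : A, altAssoc x x y = 0) (hr : ∀ x y : A, altAssoc y x x = 0)
    (s w z : A) : altAssoc s (s * w) z = altAssoc s w z * s := by
  have e1 := aux_teich s s w z
  have e2 := aux_teich z w s s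
  have e3 := aux_A2 hl hr s w z
  rw [hl s (w * z), hl s w, zero_mul, add_zero, add_zero] at e1
  rw [hr s (z * w), hr s w, mul_zero, zero_add, zero_sub] at e2
  rw [aux_sk23 hr z (w * s) s, aux_sk12 hl z s (w * s), aux_sk23 hr s z (w * s), e3,
    aux_sk23 hr z w (s * s), aux_sk12 hl z (s * s) w, aux_sk23 hr (s * s) z w,
    aux_sk23 hr z w s, aux_sk12 hl z s w, aux_sk23 hr s z w] at e2
  simp only [neg_neg, neg_mul] at e2
  have e4 : altAssoc s (s * w) z = altAssoc (s * s) w z - s * altAssoc s w z := by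
    rw [← e1]; abel
  have e5 : altAssoc (s * s) w z - s * altAssoc s w z = altAssoc s w z * s := by
    rw [← neg_inj, ← neg_mul, ← sub_eq_zero]
    rw [← sub_eq_zero] at e2
    rw [← e2]; simp only [neg_mul]; abel
  rw [e4, e5]

theorem aux_A1l (hl : ∀ x y : A, altAssoc x x y = 0) (hr : ∀ x y : A, altAssoc y x x = 0)
    (s t w z : A) : altAssoc s (t * w) z + altAssoc t (s * w) z
      = altAssoc s w z * t + altAssoc t w z * s := by
  have h := aux_A1 hl hr (s + t) w z
  have h1 := aux_A1 hl hr s w z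
  have h2 := aux_A1 hl hr t w z
  have e : altAssoc s (t * w) z + altAssoc t (s * w) z
      = altAssoc (s + t) ((s + t) * w) z - altAssoc s (s * w) z - altAssoc t (t * w) z := by
    simp only [altAssoc, mul_add, add_mul]; abel
  rw [e, h, h1, h2]
  simp only [altAssoc, mul_add, add_mul, mul_sub, sub_mul]; abel

theorem aux_A2l (hl : ∀ x y : A, altAssoc x x y = 0) (hr : ∀ x y : A, altAssoc y x x = 0)
    (s t w z : A) : altAssoc s (w * t) z + altAssoc t (w * s) z
      = s * altAssoc t w z + t * altAssoc s w z := by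
  have h := aux_A2 hl hr (s + t) w z
  have h1 := aux_A2 hl hr s w z
  have h2 := aux_A2 hl hr t w z
  have e : altAssoc s (w * t) z + altAssoc t (w * s) z
      = altAssoc (s + t) (w * (s + t)) z - altAssoc s (w * s) z - altAssoc t (w * t) z := by
    simp only [altAssoc, mul_add, add_mul]; abel
  rw [e, h, h1, h2]
  simp only [altAssoc, mul_add, add_mul, mul_sub, sub_mul]; abel

/-- `(s, w, tz) + (t, w, sz) = (s,w,z)t + (t,w,z)s`. -/
theorem aux_MAl (hl : ∀ x y : A, altAssoc x x y = 0) (hr : ∀ x y : A, altAssoc y x x = 0)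
    (s t w z : A) : altAssoc s w (t * z) + altAssoc t w (s * z)
      = altAssoc s w z * t + altAssoc t w z * s := by
  have h := aux_A1l hl hr s t z w
  rw [aux_sk23 hr s w (t * z), aux_sk23 hr t w (s * z), aux_sk23 hr s w z, aux_sk23 hr t w z,
    neg_mul, neg_mul, ← neg_add, ← neg_add, h]

/-- `(s, w, zt) + (t, w, zs) = s(t,w,z) + t(s,w,z)`. -/
theorem aux_MBl (hl : ∀ x y : A, altAssoc x x y = 0) (hr : ∀ x y : A, altAssoc y x x = 0)
    (s t w z : A) : altAssoc s w (z * t) + altAssoc t w (z * s)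
      = s * altAssoc t w z + t * altAssoc s w z := by
  have h := aux_A2l hl hr s t z w
  rw [aux_sk23 hr s w (z * t), aux_sk23 hr t w (z * s), aux_sk23 hr s w z, aux_sk23 hr t w z,
    mul_neg, mul_neg, ← neg_add, ← neg_add, h]

theorem aux_MA (hl : ∀ x y : A, altAssoc x x y = 0) (hr : ∀ x y : A, altAssoc y x x = 0)
    (s w z : A) : altAssoc s w (s * z) = altAssoc s w z * s := by
  rw [aux_sk23 hr s w (s * z), aux_A1 hl hr, aux_sk23 hr s w z, neg_mul]

theorem aux_MB (hl : ∀ x y : A, altAssoc x x y = 0) (hr : ∀ x y : A, altAssoc y x x = 0)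
    (s w z : A) : altAssoc s w (z * s) = s * altAssoc s w z := by
  rw [aux_sk23 hr s w (z * s), aux_A2 hl hr, aux_sk23 hr s w z, mul_neg]

/-- `(xa)u = a(xu)` for `u = (a,x,y)`. -/
theorem aux_C (hl : ∀ x y : A, altAssoc x x y = 0) (hr : ∀ x y : A, altAssoc y x x = 0)
    (a x y u : A) (hu : altAssoc a x y = u) : (x * a) * u = a * (x * u) := by
  have u1 : u = y * (x * a) - (y * x) * a := by
    rw [← hu, aux_sk23 hr a x y, aux_sk12 hl a y x, aux_sk23 hr y a x]
    simp only [altAssoc]; abel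
  have hx : altAssoc x a y = -u := by rw [aux_sk12 hl, hu]
  have h1 : altAssoc a x ((y * x) * a) = a * (x * u) := by
    rw [aux_MB hl hr, aux_sk12 hl a x, aux_MB hl hr, hx, mul_neg, mul_neg, mul_neg, neg_neg]
  have h2 := aux_MBl hl hr a (x * a) x y
  have h3 : altAssoc (x * a) x y = u * x := by
    rw [aux_sk12 hl, aux_A1 hl hr, hx, neg_mul, neg_neg]
  have h4 : altAssoc (x * a) x (y * a) = (a * u) * x := by
    rw [aux_sk12 hl, aux_A1 hl hr, aux_sk12 hl x a, aux_MB hl hr, hu, neg_mul, neg_neg]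
  rw [h3, h4, hu] at h2
  have h5 : altAssoc a x u = altAssoc a x (y * (x * a)) - altAssoc a x ((y * x) * a) := by
    conv_lhs => rw [u1]
    simp only [altAssoc, mul_sub]; abel
  have h6 := eq_sub_of_add_eq h2
  rw [h1, h6] at h5
  have h7 := aux_sk23 hr a x u
  rw [h5] at h7
  simp only [altAssoc] at h7
  rw [← sub_eq_zero] at h7 ⊢
  rw [← h7]; abel

theorem aux_K (hl : ∀ x y : A, altAssoc x x y = 0) (hr : ∀ x y : A, altAssoc y x x = 0)
    (a x y u : A) :
    u * (x * (a * y)) - (u * (x * a)) * y + altAssoc u x y * a - altAssoc a (u * x) y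
      + altAssoc a x (y * u) - altAssoc (a * y) x u - altAssoc (a * u) x y = 0 := by
  have rev : ∀ p q r : A, altAssoc p q r = - altAssoc r q p := fun p q r => by
    rw [aux_sk12 hl p q r, aux_sk23 hr q p r, aux_sk12 hl q r p, neg_neg]
  have h := aux_MAl hl hr a y x u
  have t := aux_teich u x a y
  rw [aux_sk12 hl a (u * x) y, rev (a * y) x u, rev (a * u) x y, rev u x y]
  rw [rev a x u] at h
  have e : u * (x * (a * y)) - (u * (x * a)) * y
      = - u * altAssoc x a y - altAssoc u (x * a) y := by
    simp only [altAssoc, mul_sub, neg_mul]; abel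
  rw [e]
  rw [← sub_eq_zero] at h t
  simp only [neg_mul] at h ⊢
  linear_combination (norm := skip) h + t
  abel

/-- The key identity. -/
theorem aux_key (hl : ∀ x y : A, altAssoc x x y = 0) (hr : ∀ x y : A, altAssoc y x x = 0)
    (a x y u : A) :
    altAssoc a ((x * a) * u - a * (x * u)) y
      = (a * u) * altAssoc a x y - (u * altAssoc a x y) * a := by
  have rev : ∀ p q r : A, altAssoc p q r = - altAssoc r q p := fun p q r => by
    rw [aux_sk12 hl p q r, aux_sk23 hr q p r, aux_sk12 hl q r p, neg_neg]
  have s0 : altAssoc a ((x * a) * u - a * (x * u)) y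
      = altAssoc a ((x * a) * u) y - altAssoc a (a * (x * u)) y := by
    simp only [altAssoc, mul_sub, sub_mul]; abel
  have r1 := aux_A1 hl hr a (x * u) y
  have r2 := eq_sub_of_add_eq (aux_A1l hl hr a (x * a) u y)
  have r3 := eq_sub_of_add_eq (aux_A1l hl hr a x u y)
  -- stage 2
  have q1 : altAssoc (x * a) (a * u) y
      = - (((a * (u * x)) * a) * y - (a * u) * (x * (a * y)) + (a * u) * altAssoc a x y) := by
    have m : (a * u) * (x * a) = (a * (u * x)) * a := by
      have : altAssoc (a * u) x a = altAssoc a u x * a := by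
        rw [aux_sk23 hr, aux_sk12 hl, neg_neg, aux_A1 hl hr]
      simp only [altAssoc, sub_mul] at this
      exact sub_right_injective this
    rw [aux_sk12 hl (x * a), aux_sk12 hl a x y]
    simp only [altAssoc, m, mul_sub, mul_neg]; abel
  have q2 : altAssoc (x * a) u y
      = - (u * altAssoc a x y) + (u * (x * (a * y)) - (u * (x * a)) * y) := by
    rw [aux_sk12 hl (x * a), aux_sk12 hl a x y]
    simp only [altAssoc, mul_sub, mul_neg]; abel
  -- stage 3
  have p1 : ((a * (u * x)) * a) * y = (a * (u * x)) * (a * y) - altAssoc a (u * x) y * a := by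
    rw [← aux_A1 hl hr a (u * x) y, aux_sk12 hl a]
    simp only [altAssoc]; abel
  have p2 : (a * u) * (x * (a * y)) = (a * (u * x)) * (a * y) + altAssoc a u x * (a * y)
      - altAssoc (a * u) x (a * y) := by
    simp only [altAssoc, sub_mul]; abel
  have p4 := eq_sub_of_add_eq (aux_MAl hl hr (a * y) a x u)
  -- `(a,x,(ay)u) + (a,x,(au)y) = (a,x,yu+uy) a`
  have p5 : altAssoc a x ((a * y) * u) + altAssoc a x ((a * u) * y)
      = altAssoc a x (y * u) * a + altAssoc a x (u * y) * a := by
    rw [← aux_MA hl hr a x (y * u), ← aux_MA hl hr a x (u * y)]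
    have h := aux_sk23 hr a y u
    have e : altAssoc a x ((a * y) * u) + altAssoc a x ((a * u) * y)
      = altAssoc a x (a * (y * u)) + altAssoc a x (a * (u * y))
        + altAssoc a x (altAssoc a y u + altAssoc a u y) := by
      simp only [altAssoc, mul_sub, mul_add]; abel
    rw [e, h, neg_add_cancel]
    simp [altAssoc]
  have p6 : altAssoc a x ((a * u) * y)
      = altAssoc a x (altAssoc a u y) + altAssoc a x (u * y) * a := by
    rw [← aux_MA hl hr a x (u * y)]
    simp only [altAssoc, mul_sub]; abel
  have p7 := rev a x (altAssoc a u y)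
  have p8 := rev (a * y) x (a * u)
  have p9 := aux_sk23 hr a u x
  have p10 := aux_sk12 hl x (a * u) y
  have p11 := aux_sk12 hl x u y
  have k := congrArg (· * a) (aux_K hl hr a x y u)
  simp only [add_mul, sub_mul, zero_mul] at k
  have p7' : altAssoc (altAssoc a u y) x a
      = altAssoc a u y * x * a - altAssoc a u y * (x * a) := rfl
  rw [s0, r1, r2, r3, q1, q2, p1, p2, p10, p11]
  simp only [add_mul, sub_mul, neg_mul]
  rw [p6] at p5
  rw [p7, p7'] at p5
  rw [p8] at p4
  rw [p9]
  simp only [neg_mul]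
  generalize altAssoc a u y = b at *
  linear_combination (norm := skip) k - p4 + p5
  abel

theorem stmt_11
    (alt_left : ∀ x y : A, altAssoc x x y = 0)
    (alt_right : ∀ x y : A, altAssoc y x x = 0)
    (a x y : A) :
    altComm (altAssoc a x y * altAssoc a x y) a = 0 := by
  have hC := aux_C alt_left alt_right a x y _ rfl
  have hk := aux_key alt_left alt_right a x y (altAssoc a x y)
  generalize altAssoc a x y = u at *
  rw [hC, sub_self] at hk
  have h2 := alt_right u a
  simp only [altAssoc, mul_zero, zero_mul, sub_self] at hk h2
  unfold altComm
  rw [← sub_eq_zero.mp hk.symm]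
  exact h2
end

section
/- In any alternative ring, [(a^2,x,y), (a,x,y)] = [(a,x,y), (a^2,x,y)]; equivalently [(a^2,x,y), (a,x,y)] = 0, where [u,v] = uv - vu and (x,y,z) = (xy)z - x(yz). -/
variable {A : Type*} [NonUnitalNonAssocRing A]

namespace AltAux

/-- Both alternative laws. -/
def IsAlt (A : Type*) [NonUnitalNonAssocRing A] : Prop :=
  (∀ x y : A, altAssoc x x y = 0) ∧ (∀ x y : A, altAssoc y x x = 0)

theorem add1 (x x' y z : A) : altAssoc (x + x') y z = altAssoc x y z + altAssoc x' y z := by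
  simp only [altAssoc, add_mul]; abel

theorem add2 (x y y' z : A) : altAssoc x (y + y') z = altAssoc x y z + altAssoc x y' z := by
  simp only [altAssoc, add_mul, mul_add]; abel

theorem add3 (x y z z' : A) : altAssoc x y (z + z') = altAssoc x y z + altAssoc x y z' := by
  simp only [altAssoc, mul_add]; abel

theorem neg3 (x y z : A) : altAssoc x y (-z) = -altAssoc x y z := by
  simp only [altAssoc, mul_neg]; abel

theorem sub2 (x y y' z : A) : altAssoc x (y - y') z = altAssoc x y z - altAssoc x y' z := by
  simp only [altAssoc, sub_mul, mul_sub]; abel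

theorem sub3 (x y z z' : A) : altAssoc x y (z - z') = altAssoc x y z - altAssoc x y z' := by
  simp only [altAssoc, mul_sub]; abel

theorem sw12 (h : IsAlt A) (x y z : A) : altAssoc y x z = -altAssoc x y z := by
  have h1 := h.1 (x + y) z
  rw [add1, add2, add2, h.1, h.1] at h1
  linear_combination (norm := abel1) h1

theorem sw23 (h : IsAlt A) (x y z : A) : altAssoc x z y = -altAssoc x y z := by
  have h1 := h.2 (y + z) x
  rw [add2, add3, add3, h.2, h.2] at h1
  linear_combination (norm := abel1) h1

theorem cyc (h : IsAlt A) (x y z : A) : altAssoc y z x = altAssoc x y z := by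
  rw [sw23 h y x z, sw12 h x y z, neg_neg]

theorem flex (h : IsAlt A) (x y : A) : altAssoc x y x = 0 := by
  rw [← cyc h, h.2]

/-- The Teichmüller identity. -/
theorem teich (w x y z : A) : altAssoc (w * x) y z - altAssoc w (x * y) z + altAssoc w x (y * z)
    = w * altAssoc x y z + altAssoc w x y * z := by
  simp only [altAssoc, mul_sub, sub_mul]; abel

theorem absR (h : IsAlt A) (x z y : A) : altAssoc x (x * z) y = altAssoc x z y * x := by
  have h2 := teich z y x x
  have h3 := teich y x x z
  have e1 : altAssoc z (y * x) x = -altAssoc x (y * x) z := by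
    rw [cyc h x z (y * x), sw23 h x (y * x) z]
  have e2 : altAssoc z y (x * x) = altAssoc y (x * x) z := (cyc h z y (x * x)).symm
  have e3 : altAssoc z y x = altAssoc x z y := cyc h x z y
  have e4 : altAssoc (y * x) x z = -altAssoc x (y * x) z := sw12 h _ _ _
  have e5 : altAssoc y x (x * z) = altAssoc x (x * z) y := (cyc h y x (x * z)).symm
  rw [h.2, h.2, mul_zero, e1, e2, e3] at h2
  rw [h.1, h.2, mul_zero, zero_mul, e4, e5] at h3
  linear_combination (norm := abel1) h3 + h2

theorem absL (h : IsAlt A) (x y z : A) : altAssoc x (y * x) z = x * altAssoc x y z := by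
  have h1 := teich x x y z
  have h3 := teich y x x z
  have e4 : altAssoc (y * x) x z = -altAssoc x (y * x) z := sw12 h _ _ _
  have e5 : altAssoc y x (x * z) = altAssoc x (x * z) y := (cyc h y x (x * z)).symm
  have e6 : altAssoc y (x * x) z = -altAssoc (x * x) y z := sw12 h _ _ _
  have e7 : altAssoc x z y = -altAssoc x y z := sw23 h _ _ _
  rw [h.1, h.1, zero_mul, absR h] at h1
  rw [h.1, h.2, mul_zero, zero_mul, e4, e5, e6, absR h, e7, neg_mul] at h3
  linear_combination (norm := abel1) h1 - h3

theorem absR_lin (h : IsAlt A) (x b z y : A) :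
    altAssoc x (b * z) y + altAssoc b (x * z) y = altAssoc x z y * b + altAssoc b z y * x := by
  have h1 := absR h (x + b) z y
  simp only [add1, add_mul, add2, mul_add, absR h] at h1
  linear_combination (norm := abel1) h1

theorem absL_lin (h : IsAlt A) (x b y z : A) :
    altAssoc x (y * b) z + altAssoc b (y * x) z = x * altAssoc b y z + b * altAssoc x y z := by
  have h1 := absL h (x + b) y z
  simp only [add1, add_mul, add2, mul_add, absL h] at h1
  linear_combination (norm := abel1) h1

/-- `(r,s,(r,s,t)) = -(r,s,t)[r,s]`. -/
theorem nestR (h : IsAlt A) (r s t : A) :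
    altAssoc r s (altAssoc r s t) = -(altAssoc r s t * altComm r s) := by
  have k : (altAssoc r s t * s) * r = altAssoc r s t * (r * s) := by
    have d : altAssoc r s (altAssoc r s t)
        = altAssoc r s ((r * s) * t) - altAssoc r s (r * (s * t)) := by
      rw [← sub3]; rfl
    have d1 : altAssoc r s (r * (s * t)) = (altAssoc r s t * s) * r := by
      rw [sw23 h r (r * (s * t)) s, absR h, sw23 h r s, neg_mul, neg_neg,
        ← cyc h r s (s * t), absR h, cyc h r s t]
    have l := absR_lin h r (r * s) t s
    have e1 : altAssoc (r * s) (r * t) s = -(s * (altAssoc r s t * r)) := by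
      rw [cyc h s (r * s) (r * t), absL h, ← cyc h s r (r * t), absR h, sw23 h r s t, neg_mul,
        mul_neg]
    have e2 : altAssoc (r * s) t s = -(s * altAssoc r s t) := by
      rw [cyc h s (r * s) t, absL h, sw12 h r s t, mul_neg]
    have e3 : altAssoc r ((r * s) * t) s = -altAssoc r s ((r * s) * t) := sw23 h _ _ _
    have e4 : altAssoc r t s = -altAssoc r s t := sw23 h _ _ _
    have e5 : altAssoc r s (altAssoc r s t)
        = (s * altAssoc r s t) * r - s * (altAssoc r s t * r) := by
      rw [← cyc h r s]; rfl
    rw [e1, e2, e3, e4, neg_mul, neg_mul] at l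
    rw [d1] at d
    linear_combination (norm := abel1) d - l - e5
  have e : altAssoc r s (altAssoc r s t) = -((altAssoc r s t * s) * r - altAssoc r s t * (s * r)) := by
    rw [cyc h (altAssoc r s t) r s, sw23 h (altAssoc r s t) s r]; rfl
  rw [e, k, altComm, mul_sub]

/-- `(r,s,(r,s,t)) = [r,s](r,s,t)`. -/
theorem nestL (h : IsAlt A) (r s t : A) :
    altAssoc r s (altAssoc r s t) = altComm r s * altAssoc r s t := by
  have k : (s * r) * altAssoc r s t = r * (s * altAssoc r s t) := by
    have d : altAssoc r s (altAssoc r s t)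
        = altAssoc r s (t * (s * r)) - altAssoc r s ((t * s) * r) := by
      rw [← sub3, ← cyc h r s t, ← cyc h s t r, sw23 h t s r, ← neg_sub, neg3, neg3]; rfl
    have d1 : altAssoc r s ((t * s) * r) = r * (s * altAssoc r s t) := by
      rw [sw23 h r ((t * s) * r) s, absL h, cyc h s r (t * s) |>.symm.symm, sw23 h s (t * s) r,
        absL h, cyc h r s t, mul_neg, neg_neg]
    have l := absL_lin h r (s * r) t s
    have e1 : altAssoc (s * r) (t * r) s = -((r * altAssoc r s t) * s) := by
      rw [cyc h s (s * r) (t * r), absR h, ← cyc h s r (t * r), absL h, sw23 h r s t, mul_neg,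
        neg_mul]
    have e2 : altAssoc (s * r) t s = -(altAssoc r s t * s) := by
      rw [cyc h s (s * r) t, absR h, sw12 h r s t, neg_mul]
    have e3 : altAssoc r (t * (s * r)) s = -altAssoc r s (t * (s * r)) := sw23 h _ _ _
    have e4 : altAssoc r t s = -altAssoc r s t := sw23 h _ _ _
    have e5 : altAssoc r s (altAssoc r s t)
        = -((r * altAssoc r s t) * s - r * (altAssoc r s t * s)) := by
      rw [sw23 h r (altAssoc r s t) s]; rfl
    rw [e1, e2, e3, e4, mul_neg, mul_neg] at l
    rw [d1] at d
    linear_combination (norm := abel1) l - d + e5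
  have e : altAssoc r s (altAssoc r s t)
      = (r * s) * altAssoc r s t - r * (s * altAssoc r s t) := rfl
  rw [e, ← k, altComm, sub_mul]

/-- `[r,s]` anticommutes with `(r,s,t)`. -/
theorem anti (h : IsAlt A) (r s t : A) :
    altAssoc r s t * altComm r s = -(altComm r s * altAssoc r s t) := by
  rw [← nestL h, nestR h, neg_neg]

theorem commAdd (a s t : A) : altComm a (s + t) = altComm a s + altComm a t := by
  simp only [altComm, mul_add, add_mul]; abel

/-- The key fact: `[a,p]` anticommutes with `p`, for `p = (a,x,y)`. -/
theorem key (h : IsAlt A) (a x y p u v q : A) (hp : altAssoc a x y = p) (hu : altComm a x = u)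
    (hv : altComm a y = v) (hq : altComm a p = q) : q * p + p * q = 0 := by
  have hp' : altAssoc a y x = -p := by rw [sw23 h a x y, hp]
  have axp : altAssoc a x p = u * p := by rw [← hp, nestL h, hu]
  have ayp : altAssoc a y p = v * p := by
    have := nestL h a y x
    rw [hp', neg3, hv, mul_neg] at this
    exact neg_injective this
  have pv : p * v = -(v * p) := by
    have := anti h a y x
    rw [hp', hv, neg_mul, mul_neg] at this
    exact neg_injective this
  have axv : altAssoc a x v = -q := by
    rw [← hv, altComm, sub3, sw23 h a (a * y) x, sw23 h a (y * a) x, absR h, absL h, hp', ← hq,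
      altComm, neg_mul, mul_neg]
    abel
  -- linearization of `[a,s] ∘ (a,s,x) = 0`
  have g : v * (u * p) + (u * p) * v + (q * p + p * q) = 0 := by
    have l := anti h a (y + p) x
    have e : altAssoc a p x = -(u * p) := by rw [sw23 h a x p, axp]
    have l1 := anti h a y x
    have l2 := anti h a p x
    rw [e, hq] at l2
    rw [hp', hv] at l1
    rw [add2, commAdd, e, hp', hv, hq] at l
    simp only [add_mul, mul_add, neg_mul, mul_neg] at l l1 l2
    linear_combination (norm := abel1) -l + l1 + l2
  -- linearization of `(a,s,(a,s,y)) = [a,s](a,s,y)`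
  have e0 : altAssoc a x (v * p) = u * (v * p) - q * p := by
    have l := nestL h a (p + x) y
    have e : altAssoc a p y = -(v * p) := by rw [sw23 h a y p, ayp]
    have l1 := nestL h a p y
    have l2 := nestL h a x y
    rw [e, hq] at l1
    rw [hp, hu] at l2
    rw [add2, add2, commAdd, e, hp, hq, hu, add3, add3, h.2] at l
    simp only [add_mul, mul_add, neg_mul, mul_neg, neg3] at l l1 l2
    linear_combination (norm := abel1) -l + l1 + l2
  have k : (u * v) * p = v * (u * p) := by
    have l := absL_lin h v a x p
    have e1 : altAssoc v (x * a) p = -((((x * a) * v) * p) - (x * a) * (v * p)) := by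
      rw [sw12 h (x * a) v p]; rfl
    have e2 : altAssoc v x p = -((x * v) * p - x * (v * p)) := by
      rw [sw12 h x v p]; rfl
    have e3 : altAssoc a (x * v) p = (a * (x * v)) * p - a * ((x * v) * p) := rfl
    have e4 : a * (x * v) = (a * x) * v + q := by
      have : altAssoc a x v = (a * x) * v - a * (x * v) := rfl
      rw [axv] at this
      linear_combination (norm := abel1) this
    have e5 : altAssoc a x (v * p) = (a * x) * (v * p) - a * (x * (v * p)) := rfl
    rw [e0] at e5
    rw [e1, e2, e3, axp, e4] at l
    have hu' := hu
    rw [altComm] at hu'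
    subst hu'
    simp only [add_mul, mul_add, neg_mul, mul_neg, mul_sub, sub_mul] at l e5 ⊢
    linear_combination (norm := abel1) l + e5
  have r : (u * p) * v = -((u * v) * p) := by
    have l := sw23 h u v p
    simp only [altAssoc, pv, mul_neg] at l
    linear_combination (norm := abel1) l
  rw [r, k] at g
  linear_combination (norm := abel1) g

end AltAux

theorem stmt_15
    (alt_left : ∀ x y : A, altAssoc x x y = 0)
    (alt_right : ∀ x y : A, altAssoc y x x = 0)
    (a x y : A) :
    altComm (altAssoc (a * a) x y) (altAssoc a x y) = altComm (altAssoc a x y) (altAssoc (a * a) x y) ∧ altComm (altAssoc (a * a) x y) (altAssoc a x y) = 0 := by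
  have h : AltAux.IsAlt A := ⟨alt_left, alt_right⟩
  have main : altComm (altAssoc (a * a) x y) (altAssoc a x y) = 0 := by
    have t := AltAux.teich a a x y
    rw [h.1, h.1, zero_mul, AltAux.absR h] at t
    have kk := AltAux.key h a x y _ _ _ _ rfl rfl rfl rfl
    have e : altAssoc (a * a) x y = a * altAssoc a x y + altAssoc a x y * a := by
      linear_combination (norm := abel1) t
    rw [e]
    have f := AltAux.flex h (altAssoc a x y) a
    have f1 := h.1 (altAssoc a x y) a
    have f2 := h.2 (altAssoc a x y) a
    generalize altAssoc a x y = p at *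
    simp only [altComm, altAssoc, mul_add, add_mul, mul_sub, sub_mul] at *
    linear_combination (norm := abel1) kk + f + f
  refine ⟨?_, main⟩
  rw [main]
  simp only [altComm] at main ⊢
  linear_combination (norm := abel1) main
end
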